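/- Let H be an m×n matrix over F₂ in which every row and every column has Hamming weight strictly greater than 3, and let q_j denote the Hamming weight of column j. Let H̃ be obtained from H by first applying the full row reduction with permutation-embedding expansions (of sizes the row weights), and then applying the full column reduction with permutation-embedding expansions of sizes q_j to the n original columns (whose weights are unchanged by row reduction). Then every nonzero codeword of C(H̃) has Hamming weight at least (3/2)·d(H)·min_j q_j; i.e., 2·d(H̃) ≥ 3·d(H)·min_j q_j. -/

import Mathlib

open Matrix

/-- The `r × (r-1)` matrix `T_r` over `F₂` with `(T_r)_{j,k} = 1` iff `j = k` or
`j = k + 1`; it is the transpose of a parity-check matrix of the `[r,1,r]`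
binary repetition code. -/
def Trep (r : ℕ) : Matrix (Fin r) (Fin (r - 1)) (ZMod 2) :=
  Matrix.of fun j k => if (j : ℕ) = (k : ℕ) ∨ (j : ℕ) = (k : ℕ) + 1 then 1 else 0

/-- `f` is a row expansion of the row `h`: each column of `f` indexed by an element of the
support of `h` has Hamming weight exactly 1, and all other columns of `f` are zero. -/
def IsRowExpansion {κ : Type*} [Fintype κ] (h : κ → ZMod 2) {r : ℕ}
    (f : Matrix (Fin r) κ (ZMod 2)) : Prop :=
  ∀ j : κ, (h j ≠ 0 → hammingNorm (fun a => f a j) = 1) ∧ (h j = 0 → ∀ a, f a j = 0)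

/-- The full row reduction via expansions `f i` of sizes `r i`: rows are indexed by the
disjoint union `⨆ i, Fin (r i)` and columns by `κ ⊕ ⨆ i, Fin (r i - 1)`; the `i`-th block
of rows equals `f i` on the original columns, equals `T_{r i}` on the `i`-th block of new
columns, and is zero on all other new-column blocks. -/
def fullRowReduction {ι κ : Type*} [DecidableEq ι]
    (r : ι → ℕ) (f : ∀ i, Matrix (Fin (r i)) κ (ZMod 2)) :
    Matrix ((i : ι) × Fin (r i)) (κ ⊕ (i : ι) × Fin (r i - 1)) (ZMod 2) :=
  Matrix.of fun a b =>
    match b with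
    | Sum.inl cc => f a.1 a.2 cc
    | Sum.inr k =>
        if a.1 = k.1 ∧ ((a.2 : ℕ) = (k.2 : ℕ) ∨ (a.2 : ℕ) = (k.2 : ℕ) + 1) then 1 else 0

/-- The full column reduction via expansions `f j` (of the columns, i.e. of the rows of
the transpose) of sizes `r j`: the transpose of the full row reduction of the transpose. -/
def fullColumnReduction {ι κ : Type*} [DecidableEq κ]
    (r : κ → ℕ) (f : ∀ j, Matrix (Fin (r j)) ι (ZMod 2)) :
    Matrix (ι ⊕ (j : κ) × Fin (r j - 1)) ((j : κ) × Fin (r j)) (ZMod 2) :=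
  (fullRowReduction r f)ᵀ

/-- The minimum distance of the code `C(H)`: the least Hamming weight of a nonzero
vector in the kernel of `H`. -/
noncomputable def minDist {ι κ : Type*} [Fintype ι] [Fintype κ]
    (H : Matrix ι κ (ZMod 2)) : ℕ :=
  sInf {w | ∃ v : κ → ZMod 2, v ≠ 0 ∧ H.mulVec v = 0 ∧ hammingNorm v = w}

theorem sum_eq_hammingNorm {κ : Type*} [Fintype κ] (x : κ → ZMod 2) :
    ∑ j, x j = (hammingNorm x : ZMod 2) := by
  have h : ∀ z : ZMod 2, z = if z ≠ 0 then 1 else 0 := by decide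
  rw [hammingNorm, Finset.card_filter, Nat.cast_sum]
  refine Finset.sum_congr rfl fun j _ => ?_
  conv_lhs => rw [h (x j)]
  split_ifs <;> simp

theorem exists_eq_single_of_hammingNorm_eq_one {κ : Type*} [Fintype κ] [DecidableEq κ]
    {x : κ → ZMod 2} (hx : hammingNorm x = 1) : ∃ j, x = Pi.single j 1 := by
  obtain ⟨j, hj⟩ := Finset.card_eq_one.mp hx
  refine ⟨j, funext fun k => ?_⟩
  have h := Finset.ext_iff.mp hj k
  simp only [Finset.mem_filter, Finset.mem_univ, true_and, Finset.mem_singleton] at h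
  have h2 : ∀ z : ZMod 2, z ≠ 0 → z = 1 := by decide
  by_cases hk : k = j
  · subst hk
    simpa using h2 _ (h.mpr rfl)
  · rw [Pi.single_eq_of_ne hk]
    exact not_not.mp (mt h.mp hk)

theorem IsRowExpansion.sum_eq {κ : Type*} [Fintype κ] {h : κ → ZMod 2} {r : ℕ}
    {f : Matrix (Fin r) κ (ZMod 2)} (hf : IsRowExpansion h f) (j : κ) : ∑ a, f a j = h j := by
  have h2 : ∀ z : ZMod 2, z ≠ 0 → z = 1 := by decide
  by_cases hj : h j = 0
  · simp [(hf j).2 hj, hj]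
  · rw [sum_eq_hammingNorm, (hf j).1 hj, h2 _ hj, Nat.cast_one]

theorem minDist_le {ι κ : Type*} [Fintype ι] [Fintype κ] {H : Matrix ι κ (ZMod 2)}
    {v : κ → ZMod 2} (hv : v ≠ 0) (hHv : H *ᵥ v = 0) : minDist H ≤ hammingNorm v :=
  Nat.sInf_le ⟨v, hv, hHv, rfl⟩

theorem Trep_succ_apply (s : ℕ) (a : Fin (s + 1)) (k : Fin s) :
    Trep (s + 1) a k = (if a = k.castSucc then 1 else 0) + if a = k.succ then 1 else 0 := by
  simp only [Trep, Matrix.of_apply, Fin.ext_iff, Fin.val_castSucc, Fin.val_succ]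
  split_ifs <;> first | omega | simp

theorem Trep_sum_apply_mul (s : ℕ) (k : Fin s) (x : Fin (s + 1) → ZMod 2) :
    ∑ a, Trep (s + 1) a k * x a = x k.castSucc + x k.succ := by
  simp [Trep_succ_apply, add_mul, Finset.sum_add_distrib]

theorem sum_Trep_apply (r : ℕ) (k : Fin (r - 1)) : ∑ a, Trep r a k = 0 := by
  cases r with
  | zero => exact k.elim0
  | succ s =>
    have h := Trep_sum_apply_mul s k 1
    simp only [Pi.one_apply, mul_one] at h
    exact h.trans (by decide)

theorem apply_eq_apply_of_Trep_transpose_mulVec_eq_zero {r : ℕ} {x : Fin r → ZMod 2}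
    (hx : ∀ k, ∑ a, Trep r a k * x a = 0) (a b : Fin r) : x a = x b := by
  cases r with
  | zero => exact a.elim0
  | succ s =>
    suffices h : ∀ a : Fin (s + 1), x a = x 0 by rw [h a, h b]
    intro a
    induction a using Fin.induction with
    | zero => rfl
    | succ k ih =>
      have h := hx k
      rw [Trep_sum_apply_mul, CharTwo.add_eq_zero] at h
      rw [← h, ih]

theorem eq_zero_of_Trep_mulVec_eq_zero {r : ℕ} {u : Fin (r - 1) → ZMod 2}
    (hu : Trep r *ᵥ u = 0) : u = 0 := by
  suffices h : ∀ (t : ℕ) (ht : t < r - 1), u ⟨t, ht⟩ = 0 from funext fun k => h k k.2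
  intro t
  induction t with
  | zero =>
    intro ht
    have h := congrFun hu ⟨0, by omega⟩
    rw [Matrix.mulVec, dotProduct, Finset.sum_eq_single ⟨0, ht⟩] at h
    · simpa [Trep] using h
    · rintro ⟨k, hk⟩ - hne
      simp only [ne_eq, Fin.mk.injEq] at hne
      simp [Trep, Ne.symm hne]
    · simp
  | succ t ih =>
    intro ht
    have h := congrFun hu ⟨t + 1, by omega⟩
    rw [Matrix.mulVec, dotProduct, Finset.sum_eq_single ⟨t + 1, ht⟩] at h
    · simpa [Trep] using h
    · rintro ⟨k, hk⟩ - hne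
      simp only [ne_eq, Fin.mk.injEq] at hne
      by_cases hkt : t = k
      · subst hkt
        rw [ih hk, mul_zero]
      · simp [Trep, Ne.symm hne, hkt]
    · simp

theorem hammingNorm_Trep_mulVec_le {r : ℕ} (u : Fin (r - 1) → ZMod 2) :
    hammingNorm (Trep r *ᵥ u) ≤ 2 * hammingNorm u := by
  cases r with
  | zero => simp [hammingNorm]
  | succ s =>
    calc hammingNorm (Trep (s + 1) *ᵥ u)
        ≤ ((Finset.univ.filter fun k : Fin s => u k ≠ 0).biUnion
            fun k => {k.castSucc, k.succ}).card := by
          refine Finset.card_le_card fun a ha => ?_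
          have hsum : ∑ k, Trep (s + 1) a k * u k ≠ 0 := (Finset.mem_filter.mp ha).2
          obtain ⟨k, -, hk⟩ := Finset.exists_ne_zero_of_sum_ne_zero hsum
          have hT := left_ne_zero_of_mul hk
          rw [Trep_succ_apply] at hT
          simp only [Finset.mem_biUnion, Finset.mem_filter, Finset.mem_univ, true_and,
            Finset.mem_insert, Finset.mem_singleton]
          refine ⟨k, right_ne_zero_of_mul hk, ?_⟩
          by_contra! hne
          simp [hne.1, hne.2] at hT
      _ ≤ hammingNorm u * 2 := Finset.card_biUnion_le_card_mul _ _ _ fun _ _ => Finset.card_le_two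
      _ = 2 * hammingNorm u := mul_comm _ _

theorem exists_Trep_mulVec_eq {r : ℕ} {y : Fin r → ZMod 2} (hy : ∑ a, y a = 0) :
    ∃ u, Trep r *ᵥ u = y := by
  cases r with
  | zero => exact ⟨0, funext fun a => a.elim0⟩
  | succ s =>
    let e : Fin s → ZMod 2 := fun k => ∑ b ∈ Finset.Iic k.castSucc, y b
    have hdiag (a : Fin (s + 1)) :
        ∑ k, (if a = k.castSucc then e k else 0) = ∑ b ∈ Finset.Iic a, y b := by
      induction a using Fin.lastCases with
      | last =>
        have hne (k : Fin s) : Fin.last s ≠ k.castSucc := (Fin.castSucc_ne_last k).symm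
        rw [← Fin.top_eq_last, Finset.Iic_top, hy, Fin.top_eq_last]
        simp [hne]
      | cast k => simp [e]
    have hsub (a : Fin (s + 1)) :
        ∑ k, (if a = k.succ then e k else 0) = ∑ b ∈ Finset.Iio a, y b := by
      induction a using Fin.cases with
      | zero =>
        have hne (k : Fin s) : 0 ≠ k.succ := (Fin.succ_ne_zero k).symm
        have hI : Finset.Iio (0 : Fin (s + 1)) = ∅ := by
          ext b
          simp
        simp [hne, hI]
      | succ k =>
        have hI : Finset.Iio k.succ = Finset.Iic k.castSucc := by
          ext b
          simp [Fin.lt_def, Fin.le_def]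
        simp [e, hI]
    refine ⟨e, funext fun a => ?_⟩
    change ∑ k : Fin s, Trep (s + 1) a k * e k = y a
    simp only [Trep_succ_apply, add_mul, ite_mul, one_mul, zero_mul,
      Finset.sum_add_distrib, hdiag, hsub]
    rw [← Finset.Iio_insert a, Finset.sum_insert Finset.notMem_Iio_self, add_assoc,
      CharTwo.add_self_eq_zero, add_zero]

theorem fullRowReduction_mulVec_apply {ι κ : Type*} [Fintype ι] [DecidableEq ι] [Fintype κ]
    (r : ι → ℕ) (f : ∀ i, Matrix (Fin (r i)) κ (ZMod 2))
    (w : κ ⊕ ((i : ι) × Fin (r i - 1)) → ZMod 2) (i : ι) (a : Fin (r i)) :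
    (fullRowReduction r f *ᵥ w) ⟨i, a⟩ =
      (f i *ᵥ fun j => w (.inl j)) a + (Trep (r i) *ᵥ fun k => w (.inr ⟨i, k⟩)) a := by
  simp only [Matrix.mulVec, dotProduct, Fintype.sum_sum_type, Fintype.sum_sigma]
  congr 1
  rw [Finset.sum_eq_single i]
  · simp [fullRowReduction, Trep]
  · intro i' _ hne
    simp [fullRowReduction, Ne.symm hne]
  · simp

/-- The codewords of a full column reduction are the codewords of the original matrix with
each bit repeated. -/
theorem fullColumnReduction_mulVec_eq_zero_iff {ι κ : Type*} [Fintype ι] [Fintype κ]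
    [DecidableEq κ] {M : Matrix ι κ (ZMod 2)} {r : κ → ℕ} (hr : ∀ j, 0 < r j)
    {f : ∀ j, Matrix (Fin (r j)) ι (ZMod 2)} (hf : ∀ j, IsRowExpansion (fun i => M i j) (f j))
    (c : ((j : κ) × Fin (r j)) → ZMod 2) :
    fullColumnReduction r f *ᵥ c = 0 ↔
      ∃ w : κ → ZMod 2, (c = fun p => w p.1) ∧ M *ᵥ w = 0 := by
  have hinl (w : κ → ZMod 2) (i : ι) :
      (fullColumnReduction r f *ᵥ fun p => w p.1) (.inl i) = (M *ᵥ w) i := by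
    simp only [Matrix.mulVec, dotProduct, Fintype.sum_sigma, ← Finset.sum_mul]
    exact Finset.sum_congr rfl fun j _ => congrArg (· * w j) ((hf j).sum_eq i)
  have hinr (c : ((j : κ) × Fin (r j)) → ZMod 2) (j : κ) (k : Fin (r j - 1)) :
      (fullColumnReduction r f *ᵥ c) (.inr ⟨j, k⟩) = ∑ a, Trep (r j) a k * c ⟨j, a⟩ := by
    simp only [Matrix.mulVec, dotProduct, Fintype.sum_sigma]
    rw [Finset.sum_eq_single j]
    · simp [fullColumnReduction, fullRowReduction, Trep]
    · intro j' _ hne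
      simp [fullColumnReduction, fullRowReduction, hne]
    · simp
  constructor
  · intro hc
    have hcw : c = fun p => c ⟨p.1, 0, hr p.1⟩ := funext fun ⟨j, a⟩ =>
      apply_eq_apply_of_Trep_transpose_mulVec_eq_zero
        (fun k => (hinr c j k).symm.trans (congrFun hc _)) a ⟨0, hr j⟩
    refine ⟨fun j => c ⟨j, 0, hr j⟩, hcw, funext fun i => ?_⟩
    rw [← hinl, ← hcw, hc]
    rfl
  · rintro ⟨w, rfl, hw⟩
    funext x
    rcases x with i | ⟨j, k⟩
    · rw [hinl, hw]
      rfl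
    · rw [hinr]
      change ∑ a, Trep (r j) a k * w j = 0
      rw [← Finset.sum_mul, sum_Trep_apply, zero_mul]

section RowReduction

variable {ι κ : Type*} [Fintype ι] [DecidableEq ι] [Fintype κ] {H : Matrix ι κ (ZMod 2)}
  {r : ι → ℕ} {f : ∀ i, Matrix (Fin (r i)) κ (ZMod 2)}

theorem IsRowExpansion.sum_mulVec {h : κ → ZMod 2} {r : ℕ} {f : Matrix (Fin r) κ (ZMod 2)}
    (hf : IsRowExpansion h f) (v : κ → ZMod 2) : ∑ a, (f *ᵥ v) a = h ⬝ᵥ v := by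
  simp only [Matrix.mulVec, dotProduct]
  rw [Finset.sum_comm]
  simp only [← Finset.sum_mul, hf.sum_eq]

theorem mulVec_eq_Trep_mulVec_of_fullRowReduction_mulVec_eq_zero
    {w : κ ⊕ ((i : ι) × Fin (r i - 1)) → ZMod 2} (hw : fullRowReduction r f *ᵥ w = 0) (i : ι) :
    (f i *ᵥ fun j => w (.inl j)) = Trep (r i) *ᵥ fun k => w (.inr ⟨i, k⟩) := by
  funext a
  have h := congrFun hw ⟨i, a⟩
  rwa [fullRowReduction_mulVec_apply, Pi.zero_apply, CharTwo.add_eq_zero] at h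

theorem mulVec_inl_eq_zero_of_fullRowReduction_mulVec_eq_zero
    (hf : ∀ i, IsRowExpansion (H i) (f i))
    {w : κ ⊕ ((i : ι) × Fin (r i - 1)) → ZMod 2} (hw : fullRowReduction r f *ᵥ w = 0) :
    (H *ᵥ fun j => w (.inl j)) = 0 := by
  funext i
  refine ((hf i).sum_mulVec _).symm.trans ?_
  rw [mulVec_eq_Trep_mulVec_of_fullRowReduction_mulVec_eq_zero hw]
  simp only [Matrix.mulVec, dotProduct]
  rw [Finset.sum_comm]
  simp [← Finset.sum_mul, sum_Trep_apply]

theorem inl_ne_zero_of_fullRowReduction_mulVec_eq_zero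
    {w : κ ⊕ ((i : ι) × Fin (r i - 1)) → ZMod 2} (hw : fullRowReduction r f *ᵥ w = 0)
    (hne : w ≠ 0) : (fun j => w (.inl j)) ≠ 0 := by
  intro h0
  apply hne
  funext x
  rcases x with j | ⟨i, k⟩
  · exact congrFun h0 j
  · have h := mulVec_eq_Trep_mulVec_of_fullRowReduction_mulVec_eq_zero hw i
    rw [h0, Matrix.mulVec_zero] at h
    exact congrFun (eq_zero_of_Trep_mulVec_eq_zero h.symm) k

theorem exists_fullRowReduction_mulVec_eq_zero (hf : ∀ i, IsRowExpansion (H i) (f i))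
    {v : κ → ZMod 2} (hv : H *ᵥ v = 0) :
    ∃ w, fullRowReduction r f *ᵥ w = 0 ∧ (fun j => w (.inl j)) = v := by
  choose u hu using fun i =>
    exists_Trep_mulVec_eq (((hf i).sum_mulVec v).trans (congrFun hv i))
  refine ⟨Sum.elim v fun p => u p.1 p.2, funext fun ⟨i, a⟩ => ?_, rfl⟩
  rw [fullRowReduction_mulVec_apply]
  simp only [Sum.elim_inl, Sum.elim_inr, hu]
  exact CharTwo.add_self_eq_zero _

/-- The number of ones of `v` in the support of `h` is at most the weight of `f *ᵥ v`, for a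
permutation-embedding expansion `f` of `h`. -/
theorem IsRowExpansion.card_le_hammingNorm_mulVec [DecidableEq κ] {h : κ → ZMod 2} {r : ℕ}
    {f : Matrix (Fin r) κ (ZMod 2)} (hf : IsRowExpansion h f)
    (hunit : ∀ a, hammingNorm (f a) = 1) (v : κ → ZMod 2) :
    (Finset.univ.filter fun j => h j ≠ 0 ∧ v j ≠ 0).card ≤ hammingNorm (f *ᵥ v) := by
  choose σ hσ using fun a => exists_eq_single_of_hammingNorm_eq_one (hunit a)
  have hmul (a : Fin r) : (f *ᵥ v) a = v (σ a) := by
    simp [Matrix.mulVec, hσ a]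
  refine Finset.card_le_card_of_surjOn σ fun j hj => ?_
  simp only [Finset.coe_filter, Finset.mem_univ, true_and, Set.mem_ofPred_eq] at hj
  rw [← hf.sum_eq j] at hj
  obtain ⟨a, -, ha⟩ := Finset.exists_ne_zero_of_sum_ne_zero hj.1
  have hja : σ a = j := by
    by_contra hne
    rw [hσ a, Pi.single_eq_of_ne (Ne.symm hne)] at ha
    exact ha rfl
  refine ⟨a, ?_, hja⟩
  simpa [hmul, hja] using hj.2

theorem hammingNorm_sigma {α : Type*} [Fintype α] {β : α → Type*} [∀ i, Fintype (β i)]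
    (u : ((i : α) × β i) → ZMod 2) : hammingNorm u = ∑ i, hammingNorm fun b => u ⟨i, b⟩ := by
  simp only [hammingNorm, Finset.card_filter, Fintype.sum_sigma]

theorem sum_hammingNorm_col_le_of_fullRowReduction_mulVec_eq_zero [DecidableEq κ]
    (hf : ∀ i, IsRowExpansion (H i) (f i)) (hunit : ∀ i a, hammingNorm (f i a) = 1)
    {w : κ ⊕ ((i : ι) × Fin (r i - 1)) → ZMod 2} (hw : fullRowReduction r f *ᵥ w = 0) :
    ∑ j with w (.inl j) ≠ 0, hammingNorm (fun i => H i j) ≤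
      2 * hammingNorm (fun p => w (.inr p)) := by
  calc ∑ j with w (.inl j) ≠ 0, hammingNorm (fun i => H i j)
      = ∑ i, (Finset.univ.filter fun j => H i j ≠ 0 ∧ w (.inl j) ≠ 0).card := by
        simp only [hammingNorm, Finset.card_filter]
        rw [Finset.sum_comm]
        refine Finset.sum_congr rfl fun i _ => ?_
        rw [Finset.sum_filter]
        refine Finset.sum_congr rfl fun j _ => ?_
        split_ifs <;> tauto
    _ ≤ ∑ i, 2 * hammingNorm fun k => w (.inr ⟨i, k⟩) := by
        refine Finset.sum_le_sum fun i _ => ((hf i).card_le_hammingNorm_mulVec (hunit i) _).trans ?_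
        rw [mulVec_eq_Trep_mulVec_of_fullRowReduction_mulVec_eq_zero hw i]
        exact hammingNorm_Trep_mulVec_le _
    _ = 2 * hammingNorm (fun p => w (.inr p)) := by
        rw [hammingNorm_sigma, Finset.mul_sum]

end RowReduction

theorem hammingNorm_repeat {κ : Type*} [Fintype κ] {r : κ → ℕ} (w : κ → ZMod 2) :
    hammingNorm (fun p : (j : κ) × Fin (r j) => w p.1) = ∑ j, if w j ≠ 0 then r j else 0 := by
  rw [hammingNorm_sigma]
  refine Finset.sum_congr rfl fun j _ => ?_
  by_cases hj : w j = 0 <;> simp [hammingNorm, hj]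

/-- Let every row and every column of `H` have weight `> 3`. Apply the full row reduction
with permutation-embedding expansions (of sizes the row weights), and then the full
column reduction with permutation-embedding expansions of sizes `q j` (the column weights
of `H`, unchanged by row reduction) to the `n` original columns, leaving the new columns
unexpanded (expansion size 1). Then every nonzero codeword of the result `H̃` has Hamming
weight at least `(3/2)·d(H)·min_j q j`, i.e. `2·d(H̃) ≥ 3·d(H)·min_j q j`. -/
theorem stmt6 {m n : ℕ}
    (H : Matrix (Fin m) (Fin n) (ZMod 2))
    (hrows : ∀ i : Fin m, 3 < hammingNorm (H i))
    (hcols : ∀ j : Fin n, 3 < hammingNorm (fun a => H a j))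
    (rr : Fin m → ℕ) (hrr : ∀ i, rr i = hammingNorm (H i))
    (fr : ∀ i, Matrix (Fin (rr i)) (Fin n) (ZMod 2))
    (hfr : ∀ i, IsRowExpansion (H i) (fr i))
    (hfrunit : ∀ i a, hammingNorm (fr i a) = 1)
    (rc : (Fin n ⊕ (i : Fin m) × Fin (rr i - 1)) → ℕ)
    (hrcOld : ∀ j : Fin n, rc (Sum.inl j) = hammingNorm (fun a => H a j))
    (hrcNew : ∀ k : (i : Fin m) × Fin (rr i - 1), rc (Sum.inr k) = 1)
    (fc : ∀ b, Matrix (Fin (rc b)) ((i : Fin m) × Fin (rr i)) (ZMod 2))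
    (hfc : ∀ b, IsRowExpansion (fun a => fullRowReduction rr fr a b) (fc b))
    (hfcunit : ∀ j : Fin n, ∀ a, hammingNorm (fc (Sum.inl j) a) = 1) :
    (∀ c : ((b : Fin n ⊕ (i : Fin m) × Fin (rr i - 1)) × Fin (rc b)) → ZMod 2, c ≠ 0 →
        (fullColumnReduction rc fc).mulVec c = 0 →
        3 * (minDist H * sInf (Set.range fun j : Fin n => hammingNorm (fun a => H a j)))
          ≤ 2 * hammingNorm c) ∧
    3 * (minDist H * sInf (Set.range fun j : Fin n => hammingNorm (fun a => H a j)))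
      ≤ 2 * minDist (fullColumnReduction rc fc) := by
  have hrc : ∀ b, 0 < rc b := by
    rintro (j | k)
    · rw [hrcOld]
      exact (Nat.zero_le _).trans_lt (hcols j)
    · rw [hrcNew]
      exact Nat.one_pos
  have main : ∀ c : ((b : Fin n ⊕ (i : Fin m) × Fin (rr i - 1)) × Fin (rc b)) → ZMod 2, c ≠ 0 →
      (fullColumnReduction rc fc).mulVec c = 0 →
      3 * (minDist H * sInf (Set.range fun j : Fin n => hammingNorm (fun a => H a j)))
        ≤ 2 * hammingNorm c := by
    intro c hc0 hc
    obtain ⟨w, rfl, hw⟩ := (fullColumnReduction_mulVec_eq_zero_iff hrc hfc c).mp hc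
    have hw0 : w ≠ 0 := by
      rintro rfl
      exact hc0 rfl
    have hd := minDist_le (inl_ne_zero_of_fullRowReduction_mulVec_eq_zero hw hw0)
      (mulVec_inl_eq_zero_of_fullRowReduction_mulVec_eq_zero hfr hw)
    have hu := sum_hammingNorm_col_le_of_fullRowReduction_mulVec_eq_zero hfr hfrunit hw
    have hq : hammingNorm (fun j => w (.inl j)) *
        sInf (Set.range fun j : Fin n => hammingNorm (fun a => H a j)) ≤
        ∑ j with w (.inl j) ≠ 0, hammingNorm (fun i => H i j) :=
      Finset.card_nsmul_le_sum _ _ _ fun j _ => Nat.sInf_le ⟨j, rfl⟩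
    have hsum : hammingNorm (fun p : (b : _) × Fin (rc b) => w p.1) =
        ∑ j with w (.inl j) ≠ 0, hammingNorm (fun i => H i j) +
          hammingNorm (fun p => w (.inr p)) := by
      rw [hammingNorm_repeat, Fintype.sum_sum_type]
      simp only [hrcOld, hrcNew, hammingNorm, Finset.sum_filter, Finset.card_filter]
    have hmul := (Nat.mul_le_mul_right _ hd).trans hq
    omega
  refine ⟨main, ?_⟩
  by_cases hne : {w | ∃ v, v ≠ 0 ∧ (fullColumnReduction rc fc).mulVec v = 0 ∧
      hammingNorm v = w}.Nonempty
  · obtain ⟨c, hc0, hc, hwt⟩ := Nat.sInf_mem hne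
    rw [minDist.eq_def (fullColumnReduction rc fc), ← hwt]
    exact main c hc0 hc
  · suffices hH : minDist H = 0 by simp [hH]
    refine Nat.sInf_eq_zero.mpr (Or.inr (Set.eq_empty_iff_forall_notMem.mpr ?_))
    rintro _ ⟨v, hv0, hv, -⟩
    obtain ⟨w, hw, rfl⟩ := exists_fullRowReduction_mulVec_eq_zero hfr hv
    refine hne ⟨_, fun p => w p.1, fun h0 => hv0 (funext fun j => ?_),
      (fullColumnReduction_mulVec_eq_zero_iff hrc hfc _).mpr ⟨w, rfl, hw⟩, rfl⟩
    exact congrFun h0 ⟨.inl j, 0, hrc _⟩
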